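/- For every λ ≥ 0 with λ + b > 0 there exists a constant C > 0 such that for every δ > 0, ∫_ℝ |e^{−λ(x+δ)}·W′(x+δ) − e^{−λx}·W′(x)|² dx ≤ C·δ (here W′ is extended by 0 on (−∞,0), so the integrand vanishes for x < −δ). -/

import Mathlib

open MeasureTheory Real Set Filter Topology

noncomputable def tailNu (ν : Measure ℝ) (y : ℝ) : ℝ := (ν (Set.Ici y)).toReal

noncomputable def itailNu (ν : Measure ℝ) (x : ℝ) : ℝ := ∫ y in Set.Ioi x, tailNu ν y

noncomputable def phi (b c : ℝ) (ν : Measure ℝ) (l : ℝ) : ℝ :=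
  b * l + c * l ^ 2 + ∫ y in Set.Ioi (0 : ℝ), (Real.exp (-l * y) - 1 + l * y) ∂ν

open ProbabilityTheory in
lemma mgf_aux (A : ℝ → ENNReal) (hA : Measurable A) (hneg : ∀ x < 0, A x = 0)
    (hL : ∀ l : ℝ, 0 < l → ∫⁻ x, ENNReal.ofReal (rexp (-l * x)) * A x = ENNReal.ofReal (1 / l)) :
    IsProbabilityMeasure (volume.withDensity (fun x => ENNReal.ofReal (rexp (-1 * x)) * A x)) ∧
    (∀ t, mgf id (volume.withDensity (fun x => ENNReal.ofReal (rexp (-1 * x)) * A x)) t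
      = if t < 1 then 1 / (1 - t) else 0) ∧
    (∀ t < 1, t ∈ integrableExpSet id
      (volume.withDensity (fun x => ENNReal.ofReal (rexp (-1 * x)) * A x))) := by
  have hm : Measurable (fun x => ENNReal.ofReal (rexp (-1 * x)) * A x) := by fun_prop
  have key : ∀ t : ℝ, ∫⁻ x, ENNReal.ofReal (rexp (t * x))
      ∂(volume.withDensity (fun x => ENNReal.ofReal (rexp (-1 * x)) * A x))
      = ∫⁻ x, ENNReal.ofReal (rexp (-(1 - t) * x)) * A x := by
    intro t
    rw [lintegral_withDensity_eq_lintegral_mul _ hm (by fun_prop)]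
    apply lintegral_congr
    intro x
    simp only [Pi.mul_apply]
    rw [mul_right_comm, ← ENNReal.ofReal_mul (exp_pos _).le, ← Real.exp_add]
    ring_nf
  refine ⟨⟨?_⟩, ?_, ?_⟩
  · have := hL 1 one_pos
    rw [withDensity_apply _ MeasurableSet.univ]
    simpa using this
  · intro t
    rw [mgf, integral_eq_lintegral_of_nonneg_ae (ae_of_all _ fun x => (exp_pos _).le)
      (by fun_prop)]
    simp only [id]
    rw [key]
    split_ifs with h
    · rw [hL _ (by linarith), ENNReal.toReal_ofReal]
      have : 0 < 1 - t := by linarith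
      positivity
    · suffices (∫⁻ x, ENNReal.ofReal (rexp (-(1 - t) * x)) * A x) = ⊤ by rw [this]; simp
      apply ENNReal.eq_top_of_forall_nnreal_le
      intro r
      have hr : (0:ℝ) < 1 / (r + 1) := by positivity
      calc (r : ENNReal) ≤ ENNReal.ofReal (1 / (1 / (r + 1))) := by
            rw [ENNReal.le_ofReal_iff_toReal_le (by simp) (by positivity)]
            simp
        _ = _ := (hL _ hr).symm
        _ ≤ _ := by
            apply lintegral_mono
            intro x
            rcases lt_or_ge x 0 with hx | hx
            · simp [hneg x hx]
            · dsimp only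
              gcongr ENNReal.ofReal (rexp ?_) * _
              have : 0 ≤ (t - 1 + 1 / (r + 1)) * x := by
                apply mul_nonneg _ hx
                push Not at h
                linarith
              nlinarith
  · intro t ht
    rw [integrableExpSet]
    refine ⟨by fun_prop, ?_⟩
    rw [hasFiniteIntegral_iff_ofReal (ae_of_all _ fun x => (exp_pos _).le)]
    simp only [id]
    rw [key, hL _ (by linarith)]
    simp

open ProbabilityTheory in
lemma laplace_unique (A B : ℝ → ENNReal) (hA : Measurable A) (hB : Measurable B)
    (hnA : ∀ x < 0, A x = 0) (hnB : ∀ x < 0, B x = 0)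
    (hLA : ∀ l : ℝ, 0 < l → ∫⁻ x, ENNReal.ofReal (rexp (-l * x)) * A x = ENNReal.ofReal (1 / l))
    (hLB : ∀ l : ℝ, 0 < l → ∫⁻ x, ENNReal.ofReal (rexp (-l * x)) * B x = ENNReal.ofReal (1 / l)) :
    A =ᵐ[volume] B := by
  obtain ⟨a1, a2, a3⟩ := mgf_aux A hA hnA hLA
  obtain ⟨b1, b2, b3⟩ := mgf_aux B hB hnB hLB
  have hmA : Measurable (fun x => ENNReal.ofReal (rexp (-1 * x)) * A x) := by fun_prop
  have hmB : Measurable (fun x => ENNReal.ofReal (rexp (-1 * x)) * B x) := by fun_prop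
  have h1 := eqOn_complexMGF_of_mgf (X := id) (Y := id)
    (μ := (volume.withDensity (fun x => ENNReal.ofReal (rexp (-1 * x)) * A x)))
    (μ' := (volume.withDensity (fun x => ENNReal.ofReal (rexp (-1 * x)) * B x)))
    (by ext t; rw [a2, b2])
  have h2 : volume.withDensity (fun x => ENNReal.ofReal (rexp (-1 * x)) * A x)
      = volume.withDensity (fun x => ENNReal.ofReal (rexp (-1 * x)) * B x) := by
    apply Measure.ext_of_charFun
    ext t
    rw [← complexMGF_id_mul_I, ← complexMGF_id_mul_I]
    apply h1
    simp only [mem_ofPred_eq]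
    rw [mem_interior_iff_mem_nhds]
    simp only [Complex.mul_re, Complex.ofReal_re, Complex.I_re, mul_zero, Complex.ofReal_im,
      Complex.I_im, mul_one, sub_zero]
    filter_upwards [Iio_mem_nhds one_pos] with s hs
    exact a3 s hs
  rw [withDensity_eq_iff_of_sigmaFinite hmA.aemeasurable hmB.aemeasurable] at h2
  filter_upwards [h2] with x hx
  exact (ENNReal.mul_right_inj (by simp [exp_pos]) (by simp)).1 hx

noncomputable def theta (t : ℝ) : ℝ := if 0 < t then 1 else if t = 0 then 1 / 2 else 0

lemma theta_add (t : ℝ) : theta t + theta (-t) = 1 := by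
  unfold theta
  rcases lt_trichotomy t 0 with h | h | h
  · simp [h, h.not_gt, h.ne]
  · subst h; norm_num
  · simp [h, h.not_gt, h.ne']

lemma theta_nonneg (t : ℝ) : 0 ≤ theta t := by
  unfold theta; split_ifs <;> norm_num

lemma theta_le (t : ℝ) : theta t ≤ 1 := by
  unfold theta; split_ifs <;> norm_num

lemma theta_meas : Measurable theta := by
  unfold theta
  refine Measurable.ite measurableSet_Ioi measurable_const ?_
  exact Measurable.ite (measurableSet_singleton 0) measurable_const measurable_const

noncomputable def SE (μ : Measure ℝ) (t : ℝ) : ENNReal := ∫⁻ a, ENNReal.ofReal (a - |t|) ∂μ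

lemma SE_meas (μ : Measure ℝ) [SFinite μ] : Measurable (SE μ) := by
  unfold SE
  apply Measurable.lintegral_prod_right'
    (f := fun p : ℝ × ℝ => ENNReal.ofReal (p.2 - |p.1|))
  fun_prop

lemma SE_neg (μ : Measure ℝ) (t : ℝ) : SE μ (-t) = SE μ t := by
  unfold SE; simp

noncomputable def ph (w : ℝ × ℝ) (x : ℝ) : ℝ := if x - w.1 < w.2 ∧ w.2 ≤ x then 1 else 0

lemma ph_nonneg (w : ℝ × ℝ) (x : ℝ) : 0 ≤ ph w x := by
  unfold ph; split_ifs <;> norm_num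

lemma ph_meas : Measurable (fun q : (ℝ × ℝ) × ℝ => ph q.1 q.2) := by
  unfold ph
  have h1 : MeasurableSet {q : (ℝ × ℝ) × ℝ | q.2 - q.1.1 < q.1.2} :=
    measurableSet_lt (by fun_prop) (by fun_prop)
  have h2 : MeasurableSet {q : (ℝ × ℝ) × ℝ | q.1.2 ≤ q.2} :=
    measurableSet_le (by fun_prop) (by fun_prop)
  exact Measurable.ite (h1.inter h2) measurable_const measurable_const

lemma ph_int (μ : Measure ℝ) [SFinite μ] (x y : ℝ) :
    ∫⁻ w, ENNReal.ofReal (ph w x * ph w y) ∂(μ.prod volume) = SE μ (x - y) := by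
  have hx : ∀ z, Measurable (fun w => ph w z) := fun z =>
    ph_meas.comp (measurable_id.prodMk measurable_const)
  rw [lintegral_prod _ (by have := hx x; have := hx y; fun_prop)]
  unfold SE
  apply lintegral_congr
  intro a
  have : ∀ s, ENNReal.ofReal (ph (a, s) x * ph (a, s) y)
      = (Ioc (x - a) x ∩ Ioc (y - a) y).indicator 1 s := by
    intro s
    unfold ph
    by_cases h1 : x - a < s ∧ s ≤ x <;> by_cases h2 : y - a < s ∧ s ≤ y <;>
      simp [indicator, h1, h2]
  simp_rw [this]
  rw [lintegral_indicator_one (measurableSet_Ioc.inter measurableSet_Ioc), Ioc_inter_Ioc,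
    Real.volume_Ioc]
  congr 1
  rcases le_total x y with h | h
  · rw [abs_of_nonpos (by linarith), sup_of_le_right (by linarith), inf_of_le_left h]; ring
  · rw [abs_of_nonneg (by linarith), sup_of_le_left (by linarith), inf_of_le_right h]; ring

lemma conv_fin (f k : ℝ → ENNReal) (hf : Measurable f) (hk : Measurable k) :
    ∫⁻ p : ℝ × ℝ, f p.1 * k (p.1 - p.2) ∂(volume.prod volume) = (∫⁻ x, f x) * ∫⁻ t, k t := by
  rw [lintegral_prod _ (by fun_prop)]
  rw [← lintegral_mul_const _ hf]
  apply lintegral_congr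
  intro x
  dsimp only
  rw [lintegral_const_mul _ (by fun_prop)]
  congr 1
  exact lintegral_sub_left_eq_self k x

lemma pd (b : ℝ) (hb : 0 ≤ b) (μ : Measure ℝ) [SFinite μ]
    (hfin : ∫⁻ t, ENNReal.ofReal (rexp (-|t|)) * SE μ t ≠ ⊤)
    (g : ℝ → ℝ) (hg : Measurable g) (M R : ℝ) (hM : ∀ x, |g x| ≤ M)
    (hR : ∀ x, R < |x| → g x = 0) :
    0 ≤ ∫ x, g x * ∫ y, (theta (x - y) * (b + (SE μ (x - y)).toReal)) * g y := by
  have hM0 : 0 ≤ M := (abs_nonneg _).trans (hM 0)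
  have hSm := SE_meas μ
  have hgi : Integrable g := by
    have : g = (Icc (-R) R).indicator g := by
      ext x
      by_cases h : x ∈ Icc (-R) R
      · simp [h]
      · rw [indicator_of_notMem h, hR]
        by_contra h'
        exact h (abs_le.1 (not_lt.1 h'))
    rw [this, integrable_indicator_iff measurableSet_Icc]
    exact Measure.integrableOn_of_bounded (M := M) (by simp) hg.aestronglyMeasurable
      (ae_of_all _ hM)
  have hbound : ∀ x y : ℝ, ENNReal.ofReal (|g x * g y|) * SE μ (x - y) ≤
      (Icc (-R) R).indicator (fun _ => ENNReal.ofReal (M ^ 2 * rexp (2 * R))) x *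
        (ENNReal.ofReal (rexp (-|x - y|)) * SE μ (x - y)) := by
    intro x y
    by_cases hx : R < |x|
    · simp [hR x hx]
    by_cases hy : R < |y|
    · simp [hR y hy]
    push Not at hx hy
    have : x ∈ Icc (-R) R := abs_le.1 hx
    simp only [this, indicator_of_mem]
    rw [← mul_assoc, ← ENNReal.ofReal_mul (by positivity)]
    gcongr ENNReal.ofReal ?_ * _
    rw [abs_mul, mul_assoc, ← Real.exp_add]
    have h1 : 1 ≤ rexp (2 * R + -|x - y|) := by
      apply Real.one_le_exp
      have := abs_sub x y
      linarith
    calc |g x| * |g y| ≤ M * M := mul_le_mul (hM x) (hM y) (abs_nonneg _) hM0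
      _ = M ^ 2 * 1 := by ring
      _ ≤ _ := by gcongr
  have hfin2 : ∫⁻ p : ℝ × ℝ, ENNReal.ofReal (|g p.1 * g p.2|) * SE μ (p.1 - p.2)
      ∂(volume.prod volume) < ⊤ := by
    refine (lintegral_mono (fun p : ℝ × ℝ => hbound p.1 p.2)).trans_lt ?_
    have := conv_fin ((Icc (-R) R).indicator (fun _ => ENNReal.ofReal (M ^ 2 * rexp (2 * R))))
      (fun t => ENNReal.ofReal (rexp (-|t|)) * SE μ t)
      (measurable_const.indicator measurableSet_Icc) (by fun_prop)
    rw [this]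
    apply ENNReal.mul_lt_top _ hfin.lt_top
    rw [lintegral_indicator measurableSet_Icc, lintegral_const]
    simp [ENNReal.mul_lt_top]
  let F : (ℝ × ℝ) → (ℝ × ℝ) → ℝ := fun p w => g p.1 * g p.2 * (ph w p.1 * ph w p.2)
  have hFm : Measurable (Function.uncurry F) := by
    have h1 : Measurable (fun q : (ℝ × ℝ) × (ℝ × ℝ) => ph q.2 q.1.1) :=
      ph_meas.comp (f := fun q : (ℝ × ℝ) × (ℝ × ℝ) => (q.2, q.1.1)) (by fun_prop)
    have h2 : Measurable (fun q : (ℝ × ℝ) × (ℝ × ℝ) => ph q.2 q.1.2) :=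
      ph_meas.comp (f := fun q : (ℝ × ℝ) × (ℝ × ℝ) => (q.2, q.1.2)) (by fun_prop)
    simp only [F, Function.uncurry_def]
    fun_prop
  have hFi : Integrable (Function.uncurry F)
      (((volume : Measure ℝ).prod (volume : Measure ℝ)).prod (μ.prod volume)) := by
    refine ⟨hFm.aestronglyMeasurable, ?_⟩
    rw [hasFiniteIntegral_iff_norm, lintegral_prod _ (by fun_prop)]
    refine lt_of_eq_of_lt ?_ hfin2
    apply lintegral_congr
    intro p
    rw [← ph_int, ← lintegral_const_mul']
    · apply lintegral_congr
      intro w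
      simp only [F, Function.uncurry_apply_pair]
      rw [← ENNReal.ofReal_mul (abs_nonneg _), Real.norm_eq_abs, abs_mul (g p.1 * g p.2),
        abs_of_nonneg (mul_nonneg (ph_nonneg _ _) (ph_nonneg _ _))]
    · exact ENNReal.ofReal_ne_top
  have hFS : ∀ p, ∫ w, F p w ∂(μ.prod volume) = g p.1 * g p.2 * (SE μ (p.1 - p.2)).toReal := by
    intro p
    simp only [F]
    rw [integral_const_mul, integral_eq_lintegral_of_nonneg_ae
      (ae_of_all _ fun w => mul_nonneg (ph_nonneg _ _) (ph_nonneg _ _)), ph_int]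
    have hx : ∀ z, Measurable (fun w => ph w z) := fun z =>
      ph_meas.comp (measurable_id.prodMk measurable_const)
    exact ((hx _).mul (hx _)).aestronglyMeasurable
  have hGi : Integrable (fun p : ℝ × ℝ => g p.1 * g p.2 * (SE μ (p.1 - p.2)).toReal)
      (volume.prod volume) := by
    have := hFi.integral_prod_left
    simpa only [Function.uncurry_apply_pair, hFS] using this
  have hG0 : 0 ≤ ∫ p : ℝ × ℝ, g p.1 * g p.2 * (SE μ (p.1 - p.2)).toReal
      ∂(volume.prod volume) := by
    simp_rw [← hFS]
    rw [integral_integral_swap hFi]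
    apply integral_nonneg
    intro w
    have : ∀ p : ℝ × ℝ, F p w = (fun x => g x * ph w x) p.1 * (fun x => g x * ph w x) p.2 := by
      intro p; simp only [F]; ring
    change 0 ≤ ∫ p, F p w ∂(volume.prod volume)
    rw [integral_congr_ae (ae_of_all _ this),
      integral_prod_mul (fun x => g x * ph w x) (fun x => g x * ph w x)]
    exact mul_self_nonneg _
  have hBi : Integrable (fun p : ℝ × ℝ => g p.1 * g p.2) (volume.prod volume) := hgi.mul_prod hgi
  have hB0 : 0 ≤ ∫ p : ℝ × ℝ, g p.1 * g p.2 ∂(volume.prod volume) := by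
    rw [integral_prod_mul]; exact mul_self_nonneg _
  let H : ℝ × ℝ → ℝ := fun p => g p.1 * g p.2 * (b + (SE μ (p.1 - p.2)).toReal)
  have hH' : H = fun p => b * (g p.1 * g p.2) + g p.1 * g p.2 * (SE μ (p.1 - p.2)).toReal := by
    ext p; simp only [H]; ring
  have hHi : Integrable H (volume.prod volume) := by
    rw [hH']; exact (hBi.const_mul b).add hGi
  have hH0 : 0 ≤ ∫ p, H p ∂(volume.prod volume) := by
    rw [hH', integral_add (hBi.const_mul b) hGi, integral_const_mul]
    positivity
  have hTi : Integrable (fun p : ℝ × ℝ => theta (p.1 - p.2) * H p) (volume.prod volume) := by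
    apply hHi.bdd_mul (c := 1)
    · exact (theta_meas.comp (by fun_prop)).aestronglyMeasurable
    · refine ae_of_all _ fun p => ?_
      rw [Real.norm_eq_abs, abs_of_nonneg (theta_nonneg _)]; exact theta_le _
  have hsw : ∫ p : ℝ × ℝ, theta (p.1 - p.2) * H p ∂(volume.prod volume)
      = ∫ p : ℝ × ℝ, theta (-(p.1 - p.2)) * H p ∂(volume.prod volume) := by
    rw [← integral_prod_swap]
    congr 1; ext p
    simp only [Prod.fst_swap, Prod.snd_swap, H]
    rw [← SE_neg μ, neg_sub, neg_sub, mul_comm (g p.2)]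
  have hTi2 : Integrable (fun p : ℝ × ℝ => theta (-(p.1 - p.2)) * H p) (volume.prod volume) := by
    have : (fun p : ℝ × ℝ => theta (-(p.1 - p.2)) * H p)
      = fun p => H p - theta (p.1 - p.2) * H p := by
      ext p; have := theta_add (p.1 - p.2); linear_combination (H p) * this
    rw [this]; exact hHi.sub hTi
  have hsum : 0 ≤ ∫ p : ℝ × ℝ, theta (p.1 - p.2) * H p ∂(volume.prod volume) := by
    have : ∫ p : ℝ × ℝ, theta (p.1 - p.2) * H p ∂(volume.prod volume)
      + ∫ p : ℝ × ℝ, theta (-(p.1 - p.2)) * H p ∂(volume.prod volume)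
      = ∫ p, H p ∂(volume.prod volume) := by
      rw [← integral_add hTi hTi2]
      congr 1; ext p; rw [← add_mul, theta_add, one_mul]
    linarith
  rw [integral_prod _ hTi] at hsum
  refine hsum.trans_eq ?_
  congr 1; ext x
  rw [← integral_const_mul]
  congr 1; ext y
  simp only [H]; ring

lemma lint_theta (f : ℝ → ENNReal) :
    ∫⁻ t, ENNReal.ofReal (theta t) * f t = ∫⁻ t in Ioi 0, f t := by
  rw [← lintegral_indicator measurableSet_Ioi]
  apply lintegral_congr_ae
  have : ∀ᵐ t : ℝ, t ≠ 0 := by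
    simp [ae_iff]
  filter_upwards [this] with t ht
  unfold theta
  by_cases h : 0 < t
  · simp [h]
  · simp [h, ht]

lemma lap_theta (l : ℝ) (hl : 0 < l) :
    ∫⁻ t, ENNReal.ofReal (rexp (-l * t)) * ENNReal.ofReal (theta t) = ENNReal.ofReal (1 / l) := by
  simp_rw [mul_comm _ (ENNReal.ofReal (theta _))]
  rw [lint_theta, ← ofReal_integral_eq_lintegral_ofReal
    (integrableOn_exp_mul_Ioi (by linarith) 0) (ae_of_all _ fun x => (exp_pos _).le),
    integral_exp_mul_Ioi (by linarith)]
  simp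

lemma lap_conv (l : ℝ) (K f : ℝ → ENNReal) (hK : Measurable K) (hf : Measurable f) :
    ∫⁻ x, ENNReal.ofReal (rexp (-l * x)) * ∫⁻ y, K (x - y) * f y
      = (∫⁻ t, ENNReal.ofReal (rexp (-l * t)) * K t) *
        ∫⁻ y, ENNReal.ofReal (rexp (-l * y)) * f y := by
  have h1 : ∀ x, ENNReal.ofReal (rexp (-l * x)) * ∫⁻ y, K (x - y) * f y
      = ∫⁻ y, (ENNReal.ofReal (rexp (-l * (x - y))) * K (x - y)) *
        (ENNReal.ofReal (rexp (-l * y)) * f y) := by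
    intro x
    rw [← lintegral_const_mul _ (by fun_prop)]
    apply lintegral_congr
    intro y
    have : rexp (-l * x) = rexp (-l * (x - y)) * rexp (-l * y) := by
      rw [← Real.exp_add]; ring_nf
    rw [this, ENNReal.ofReal_mul (exp_pos _).le]
    ring
  simp_rw [h1]
  rw [lintegral_lintegral_swap (by fun_prop), ← lintegral_const_mul _ (by fun_prop)]
  apply lintegral_congr
  intro y
  rw [lintegral_mul_const _ (by fun_prop)]
  congr 1
  exact lintegral_sub_right_eq_self (fun t => ENNReal.ofReal (rexp (-l * t)) * K t) y

lemma lap_inner (l a : ℝ) (hl : 0 < l) (ha : 0 < a) :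
    ∫⁻ t in Ioi 0, ENNReal.ofReal (rexp (-l * t)) * ENNReal.ofReal (a - |t|)
      = ENNReal.ofReal ((rexp (-l * a) - 1 + l * a) / l ^ 2) := by
  have h1 : ∫⁻ t in Ioi 0, ENNReal.ofReal (rexp (-l * t)) * ENNReal.ofReal (a - |t|)
      = ∫⁻ t in Ioc 0 a, ENNReal.ofReal (rexp (-l * t) * (a - t)) := by
    rw [← lintegral_indicator measurableSet_Ioi, ← lintegral_indicator measurableSet_Ioc]
    apply lintegral_congr
    intro t
    by_cases h : 0 < t
    · by_cases h2 : t ≤ a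
      · simp [indicator, h, h2, abs_of_pos h, ENNReal.ofReal_mul (exp_pos _).le]
      · have : a - |t| ≤ 0 := by rw [abs_of_pos h]; linarith
        simp [indicator, h2, ENNReal.ofReal_of_nonpos this]
    · simp [indicator, h]
  have hc : Continuous (fun t => rexp (-l * t) * (a - t)) := by fun_prop
  rw [h1, ← ofReal_integral_eq_lintegral_ofReal]
  · congr 1
    rw [← intervalIntegral.integral_of_le ha.le]
    rw [intervalIntegral.integral_eq_sub_of_hasDerivAt
      (f := fun t => -(rexp (-l * t) * (a - t)) / l + rexp (-l * t) / l ^ 2) _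
      (hc.intervalIntegrable _ _)]
    · simp only [mul_zero, Real.exp_zero]
      field_simp
      ring
    · intro t _
      have e : HasDerivAt (fun t => rexp (-l * t)) (rexp (-l * t) * (-l * 1)) t :=
        ((hasDerivAt_id t).const_mul (-l)).exp
      have := ((e.mul ((hasDerivAt_id t).const_sub a)).neg.div_const l).add (e.div_const (l ^ 2))
      refine this.congr_deriv ?_
      simp only [id]
      field_simp
      ring
  · exact (hc.integrableOn_Icc (a := 0) (b := a)).mono_set Ioc_subset_Icc_self
  · filter_upwards [ae_restrict_mem measurableSet_Ioc] with t ht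
    exact mul_nonneg (exp_pos _).le (by linarith [ht.2])

lemma lap_SE (ν : Measure ℝ) [SFinite (ν.restrict (Ioi 0))] (l : ℝ) (hl : 0 < l) :
    ∫⁻ t in Ioi 0, ENNReal.ofReal (rexp (-l * t)) * SE (ν.restrict (Ioi 0)) t
      = ∫⁻ a in Ioi 0, ENNReal.ofReal ((rexp (-l * a) - 1 + l * a) / l ^ 2) ∂ν := by
  unfold SE
  simp_rw [← lintegral_const_mul' _ _ ENNReal.ofReal_ne_top]
  rw [lintegral_lintegral_swap (by fun_prop)]
  apply setLIntegral_congr_fun measurableSet_Ioi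
  intro a ha
  exact lap_inner l a hl ha

lemma exp_bd0 (z : ℝ) : 0 ≤ rexp (-z) - 1 + z := by
  linarith [Real.add_one_le_exp (-z)]

lemma exp_bd2 (z : ℝ) (hz : 0 ≤ z) : rexp (-z) - 1 + z ≤ z ^ 2 := by
  have h := Real.add_one_le_exp z
  have h1 : rexp (-z) ≤ 1 / (1 + z) := by
    rw [Real.exp_neg, ← one_div]
    apply one_div_le_one_div_of_le <;> linarith
  have h2 : 1 / (1 + z) ≤ 1 - z + z ^ 2 := by
    rw [div_le_iff₀ (by linarith)]
    nlinarith [pow_nonneg hz 3]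
  linarith

lemma phi_fin (ν : Measure ℝ)
    (hνint : ∫⁻ y in Set.Ioi (0 : ℝ), ENNReal.ofReal (min y (y ^ 2)) ∂ν ≠ ⊤)
    (l : ℝ) (hl : 0 < l) :
    ∫⁻ a in Ioi 0, ENNReal.ofReal (rexp (-l * a) - 1 + l * a) ∂ν ≠ ⊤ := by
  refine ne_top_of_le_ne_top (ENNReal.mul_ne_top (ENNReal.ofReal_ne_top (r := l + l ^ 2)) hνint) ?_
  rw [← lintegral_const_mul' _ _ ENNReal.ofReal_ne_top]
  apply setLIntegral_mono' measurableSet_Ioi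
  intro a ha
  have ha : 0 < a := ha
  rw [← ENNReal.ofReal_mul (by positivity)]
  apply ENNReal.ofReal_le_ofReal
  have h0 : 0 < l * a := by positivity
  have h1 := exp_bd2 (l * a) h0.le
  have h2 : rexp (-(l * a)) ≤ 1 := Real.exp_le_one_iff.2 (by linarith)
  rw [neg_mul]
  rcases min_cases a (a ^ 2) with ⟨h, _⟩ | ⟨h, _⟩ <;> rw [h]
  · nlinarith [mul_pos (mul_pos hl hl) ha]
  · nlinarith [mul_pos hl (mul_pos ha ha)]

lemma phi_eq (b c : ℝ) (hb : 0 ≤ b) (_hc : 0 < c) (ν : Measure ℝ)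
    (hνint : ∫⁻ y in Set.Ioi (0 : ℝ), ENNReal.ofReal (min y (y ^ 2)) ∂ν ≠ ⊤)
    (l : ℝ) (hl : 0 < l) :
    c * l ^ 2 ≤ phi b c ν l ∧
    ENNReal.ofReal (b / l) + ∫⁻ a in Ioi 0, ENNReal.ofReal ((rexp (-l * a) - 1 + l * a) / l ^ 2) ∂ν
      = ENNReal.ofReal (phi b c ν l / l ^ 2 - c) := by
  have hfin := phi_fin ν hνint l hl
  have hI : ∫ y in Set.Ioi (0 : ℝ), (Real.exp (-l * y) - 1 + l * y) ∂ν
      = (∫⁻ a in Ioi 0, ENNReal.ofReal (rexp (-l * a) - 1 + l * a) ∂ν).toReal := by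
    apply integral_eq_lintegral_of_nonneg_ae
    · exact ae_of_all _ fun y => by have := exp_bd0 (l * y); rw [← neg_mul] at this; exact this
    · fun_prop
  have hI' : ∫⁻ a in Ioi 0, ENNReal.ofReal ((rexp (-l * a) - 1 + l * a) / l ^ 2) ∂ν
      = ENNReal.ofReal ((∫ y in Set.Ioi (0 : ℝ), (Real.exp (-l * y) - 1 + l * y) ∂ν) / l ^ 2) := by
    rw [hI, div_eq_inv_mul, ENNReal.ofReal_mul (by positivity), ENNReal.ofReal_toReal hfin,
      ← lintegral_const_mul' _ _ ENNReal.ofReal_ne_top]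
    apply lintegral_congr
    intro a
    rw [div_eq_inv_mul, ENNReal.ofReal_mul (by positivity)]
  have hI0 : 0 ≤ ∫ y in Set.Ioi (0 : ℝ), (Real.exp (-l * y) - 1 + l * y) ∂ν := by
    rw [hI]; exact ENNReal.toReal_nonneg
  refine ⟨?_, ?_⟩
  · unfold phi
    have : 0 ≤ b * l := by positivity
    linarith
  · rw [hI', ← ENNReal.ofReal_add (by positivity) (by positivity)]
    congr 1
    unfold phi
    field_simp
    ring

lemma sfin (ν : Measure ℝ)
    (hνint : ∫⁻ y in Set.Ioi (0 : ℝ), ENNReal.ofReal (min y (y ^ 2)) ∂ν ≠ ⊤) :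
    SFinite (ν.restrict (Ioi 0)) := by
  have hm : Measurable (fun y : ℝ => ENNReal.ofReal (min y (y ^ 2))) := by fun_prop
  have h := withDensity_inv_same₀ (μ := ν.restrict (Ioi 0))
    (f := fun y : ℝ => ENNReal.ofReal (min y (y ^ 2))) hm.aemeasurable
    (by
      filter_upwards [ae_restrict_mem measurableSet_Ioi] with t ht
      have ht : 0 < t := ht
      simp [ht, ht.ne'])
    (by simp)
  have : IsFiniteMeasure ((ν.restrict (Ioi 0)).withDensity
    (fun y : ℝ => ENNReal.ofReal (min y (y ^ 2)))) := isFiniteMeasure_withDensity hνint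
  rw [← h]
  infer_instance

noncomputable def kE (b : ℝ) (μ : Measure ℝ) (t : ℝ) : ENNReal :=
  ENNReal.ofReal (theta t) * (ENNReal.ofReal b + SE μ t)

lemma kE_meas (b : ℝ) (μ : Measure ℝ) [SFinite μ] : Measurable (kE b μ) := by
  have := SE_meas μ
  have := theta_meas
  unfold kE
  fun_prop

lemma lap_kE (b c : ℝ) (hb : 0 ≤ b) (hc : 0 < c) (ν : Measure ℝ)
    (hνint : ∫⁻ y in Set.Ioi (0 : ℝ), ENNReal.ofReal (min y (y ^ 2)) ∂ν ≠ ⊤)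
    (l : ℝ) (hl : 0 < l) :
    ∫⁻ t, ENNReal.ofReal (rexp (-l * t)) * kE b (ν.restrict (Ioi 0)) t
      = ENNReal.ofReal (phi b c ν l / l ^ 2 - c) := by
  have := sfin ν hνint
  have := SE_meas (ν.restrict (Ioi 0))
  rw [← (phi_eq b c hb hc ν hνint l hl).2, ← lap_SE ν l hl]
  have h1 : ENNReal.ofReal (b / l) = ∫⁻ t in Ioi 0, ENNReal.ofReal (rexp (-l * t)) * ENNReal.ofReal b := by
    rw [lintegral_mul_const _ (by fun_prop), ← lint_theta]
    simp_rw [mul_comm (ENNReal.ofReal (theta _))]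
    rw [lap_theta l hl, ← ENNReal.ofReal_mul (by positivity)]
    congr 1; ring
  rw [h1, ← lintegral_add_left (by fun_prop), ← lint_theta]
  apply lintegral_congr
  intro t
  unfold kE
  ring

lemma lap_u (b c : ℝ) (hb : 0 ≤ b) (hc : 0 < c)
    (ν : Measure ℝ)
    (hνint : ∫⁻ y in Set.Ioi (0 : ℝ), ENNReal.ofReal (min y (y ^ 2)) ∂ν ≠ ⊤)
    (W W' : ℝ → ℝ)
    (hWnonneg : ∀ x : ℝ, 0 ≤ W x)
    (hWcont : ContinuousOn W (Set.Ici 0))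
    (hWmono : StrictMonoOn W (Set.Ici 0))
    (hWlap : ∀ l : ℝ, 0 < l →
      (∫ x in Set.Ioi (0 : ℝ), Real.exp (-l * x) * W x) = 1 / phi b c ν l)
    (hW'neg : ∀ x : ℝ, x < 0 → W' x = 0)
    (hW'deriv : ∀ x : ℝ, 0 < x → HasDerivAt W (W' x) x)
    (hW'cont : ContinuousOn W' (Set.Ici 0)) (hm : Measurable W') (hn : ∀ x, 0 ≤ W' x)
    (l : ℝ) (hl : 0 < l) :
    ∫⁻ x, ENNReal.ofReal (rexp (-l * x)) * ENNReal.ofReal (W' x)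
      = ENNReal.ofReal (l / phi b c ν l) := by
  have hphi : ∀ l : ℝ, 0 < l → 0 < phi b c ν l := fun l hl =>
    lt_of_lt_of_le (by positivity) (phi_eq b c hb hc ν hνint l hl).1
  have hLW : ∀ l : ℝ, 0 < l → ∫⁻ x in Ioi 0, ENNReal.ofReal (rexp (-l * x)) * ENNReal.ofReal (W x)
      = ENNReal.ofReal (1 / phi b c ν l) := by
    intro l hl
    have hp := hphi l hl
    have hi : Integrable (fun x => rexp (-l * x) * W x) (volume.restrict (Ioi 0)) := by
      apply Integrable.of_integral_ne_zero
      rw [hWlap l hl]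
      positivity
    rw [← hWlap l hl, ofReal_integral_eq_lintegral_ofReal hi
      (ae_of_all _ fun x => mul_nonneg (exp_pos _).le (hWnonneg x))]
    apply lintegral_congr
    intro x
    rw [ENNReal.ofReal_mul (exp_pos _).le]
  have hE : ∀ l : ℝ, 0 < l → ∫⁻ x in Ioi 0, ENNReal.ofReal (rexp (-l * x))
      = ENNReal.ofReal (1 / l) := by
    intro l hl
    rw [← lint_theta, ← lap_theta l hl]
    simp_rw [mul_comm]
  have hW0 : W 0 = 0 := by
    apply le_antisymm _ (hWnonneg 0)
    have h1 : ∀ l : ℝ, 0 < l → W 0 ≤ 1 / c * (1 / l) := by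
      intro l hl
      have h2 : ENNReal.ofReal (1 / l) * ENNReal.ofReal (W 0) ≤ ENNReal.ofReal (1 / phi b c ν l) := by
        rw [← hLW l hl, ← hE l hl, ← lintegral_mul_const _ (by fun_prop)]
        apply setLIntegral_mono' measurableSet_Ioi
        intro x hx
        have hx : 0 < x := hx
        gcongr
        exact (hWmono (by simp) (by simp [hx.le]) hx).le
      rw [← ENNReal.ofReal_mul (by positivity), ENNReal.ofReal_le_ofReal_iff
        (by have := hphi l hl; positivity)] at h2
      have h3 : 1 / phi b c ν l ≤ 1 / (c * l ^ 2) :=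
        one_div_le_one_div_of_le (by positivity) (phi_eq b c hb hc ν hνint l hl).1
      have h4 : l * (1 / l * W 0) ≤ l * (1 / (c * l ^ 2)) :=
        mul_le_mul_of_nonneg_left (h2.trans h3) hl.le
      calc W 0 = l * (1 / l * W 0) := by field_simp
        _ ≤ _ := h4
        _ = _ := by field_simp
    have ht : Tendsto (fun l : ℝ => 1 / c * (1 / l)) atTop (𝓝 (1 / c * 0)) := by
      apply Tendsto.const_mul
      exact tendsto_const_nhds.div_atTop tendsto_id
    rw [mul_zero] at ht
    apply ge_of_tendsto ht
    filter_upwards [eventually_gt_atTop 0] with l hl using h1 l hl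
  have hconv : ∀ x : ℝ, x ≠ 0 → ∫⁻ y, ENNReal.ofReal (theta (x - y)) * ENNReal.ofReal (W' y)
      = ENNReal.ofReal (theta x) * ENNReal.ofReal (W x) := by
    intro x hx0
    have : ∀ᵐ y : ℝ, y ≠ x := by simp [ae_iff]
    have h0 : ∀ᵐ y : ℝ, y ≠ 0 := by simp [ae_iff]
    have h1 : ∫⁻ y, ENNReal.ofReal (theta (x - y)) * ENNReal.ofReal (W' y)
      = ∫⁻ y in Ioc 0 x, ENNReal.ofReal (W' y) := by
      rw [← lintegral_indicator measurableSet_Ioc]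
      apply lintegral_congr_ae
      filter_upwards [this, h0] with y hy hy0
      rcases lt_or_gt_of_ne hy0 with h | h
      · simp [indicator, hW'neg y h, h.not_gt]
      rcases lt_or_gt_of_ne hy with h' | h'
      · simp [indicator, h, h'.le, theta, h']
      · have : x - y ≠ 0 := by intro hh; linarith
        simp [indicator, h'.not_ge, theta, h'.not_gt, this]
    rw [h1]
    rcases lt_or_gt_of_ne hx0 with h | h
    · simp [theta, h.not_gt, h.ne]
    · have hcI : ContinuousOn W' (Icc 0 x) := hW'cont.mono Icc_subset_Ici_self
      have hii : IntervalIntegrable W' volume 0 x :=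
        ContinuousOn.intervalIntegrable (by rwa [uIcc_of_le h.le])
      rw [← ofReal_integral_eq_lintegral_ofReal _ (ae_of_all _ hn),
        ← intervalIntegral.integral_of_le h.le,
        intervalIntegral.integral_eq_sub_of_hasDerivAt_of_le h.le
          (hWcont.mono Icc_subset_Ici_self) (fun y hy => hW'deriv y hy.1) hii, hW0]
      · simp [theta, h]
      · exact (intervalIntegrable_iff_integrableOn_Ioc_of_le h.le).1 hii
  have hth := theta_meas
  have h1 := lap_conv l (fun t => ENNReal.ofReal (theta t)) (fun t => ENNReal.ofReal (W' t))
    (by fun_prop) (by fun_prop)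
  rw [lap_theta l hl] at h1
  have h2 : ∫⁻ x, ENNReal.ofReal (rexp (-l * x)) * ∫⁻ y, ENNReal.ofReal (theta (x - y)) * ENNReal.ofReal (W' y)
      = ENNReal.ofReal (1 / phi b c ν l) := by
    rw [← hLW l hl, ← lint_theta]
    apply lintegral_congr_ae
    have h0 : ∀ᵐ y : ℝ, y ≠ 0 := by simp [ae_iff]
    filter_upwards [h0] with x hx
    rw [hconv x hx]
    ring
  rw [h2] at h1
  have h3 : ENNReal.ofReal l * ENNReal.ofReal (1 / l) = 1 := by
    rw [← ENNReal.ofReal_mul hl.le]; simp [hl.ne']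
  calc _ = ENNReal.ofReal l * (ENNReal.ofReal (1 / l) *
        ∫⁻ x, ENNReal.ofReal (rexp (-l * x)) * ENNReal.ofReal (W' x)) := by
        rw [← mul_assoc, h3, one_mul]
    _ = _ := by
        rw [← h1, ← ENNReal.ofReal_mul hl.le]
        congr 1; ring

lemma main_eq (b c : ℝ) (hb : 0 ≤ b) (hc : 0 < c)
    (ν : Measure ℝ)
    (hνint : ∫⁻ y in Set.Ioi (0 : ℝ), ENNReal.ofReal (min y (y ^ 2)) ∂ν ≠ ⊤)
    (u : ℝ → ℝ) (hm : Measurable u) (hu : ∀ x < 0, u x = 0)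
    (hL : ∀ l : ℝ, 0 < l → ∫⁻ x, ENNReal.ofReal (rexp (-l * x)) * ENNReal.ofReal (u x)
      = ENNReal.ofReal (l / phi b c ν l)) :
    ∀ᵐ x : ℝ, ENNReal.ofReal c * ENNReal.ofReal (u x)
      + ∫⁻ y, kE b (ν.restrict (Ioi 0)) (x - y) * ENNReal.ofReal (u y)
      = ENNReal.ofReal (theta x) := by
  have := sfin ν hνint
  have hk := kE_meas b (ν.restrict (Ioi 0))
  have hth := theta_meas
  have hcm : Measurable (fun x => ∫⁻ y, kE b (ν.restrict (Ioi 0)) (x - y) * ENNReal.ofReal (u y)) := by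
    apply Measurable.lintegral_prod_right'
      (f := fun p : ℝ × ℝ => kE b (ν.restrict (Ioi 0)) (p.1 - p.2) * ENNReal.ofReal (u p.2))
    fun_prop
  have hth0 : ∀ x < 0, theta x = 0 := by
    intro x hx; simp [theta, hx.not_gt, hx.ne]
  refine laplace_unique (fun x => ENNReal.ofReal c * ENNReal.ofReal (u x)
      + ∫⁻ y, kE b (ν.restrict (Ioi 0)) (x - y) * ENNReal.ofReal (u y))
      (fun x => ENNReal.ofReal (theta x)) (by fun_prop) (by fun_prop) ?_ ?_ ?_ lap_theta
  · intro x hx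
    simp only [hu x hx, ENNReal.ofReal_zero, mul_zero, zero_add]
    rw [lintegral_eq_zero_iff (by fun_prop)]
    refine ae_of_all _ fun y => ?_
    rcases lt_or_ge y 0 with h | h
    · simp [hu y h]
    · simp [kE, hth0 (x - y) (by linarith)]
  · intro x hx
    simp [hth0 x hx]
  · intro l hl
    simp_rw [mul_add]
    rw [lintegral_add_left (by fun_prop), lap_conv l _ _ hk (by fun_prop),
      lap_kE b c hb hc ν hνint l hl, hL l hl]
    simp_rw [mul_left_comm _ (ENNReal.ofReal c)]
    rw [lintegral_const_mul _ (by fun_prop), hL l hl, ← add_mul]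
    have hp := (phi_eq b c hb hc ν hνint l hl).1
    have hp0 : 0 < phi b c ν l := lt_of_lt_of_le (by positivity) hp
    have : 0 ≤ phi b c ν l / l ^ 2 - c := by
      rw [sub_nonneg, le_div_iff₀ (by positivity)]; exact hp
    rw [← ENNReal.ofReal_add hc.le this, ← ENNReal.ofReal_mul (by linarith)]
    congr 1
    field_simp
    ring

lemma hfin_lem (ν : Measure ℝ)
    (hνint : ∫⁻ y in Set.Ioi (0 : ℝ), ENNReal.ofReal (min y (y ^ 2)) ∂ν ≠ ⊤) :
    ∫⁻ t, ENNReal.ofReal (rexp (-|t|)) * SE (ν.restrict (Ioi 0)) t ≠ ⊤ := by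
  have := sfin ν hνint
  have hS := SE_meas (ν.restrict (Ioi 0))
  have hth := theta_meas
  set f : ℝ → ENNReal := fun t => ENNReal.ofReal (rexp (-|t|)) * SE (ν.restrict (Ioi 0)) t with hf
  have h1 : ∫⁻ t, ENNReal.ofReal (theta t) * f t ≠ ⊤ := by
    rw [lint_theta]
    have h := lap_SE ν 1 one_pos
    have h2 : ∫⁻ t in Ioi 0, f t
        = ∫⁻ t in Ioi 0, ENNReal.ofReal (rexp (-1 * t)) * SE (ν.restrict (Ioi 0)) t := by
      apply setLIntegral_congr_fun measurableSet_Ioi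
      intro t ht
      have ht : 0 < t := ht
      simp [hf, abs_of_pos ht]
    rw [h2, h]
    simpa using phi_fin ν hνint 1 one_pos
  have h2 : ∫⁻ t, f t = (∫⁻ t, ENNReal.ofReal (theta t) * f t)
      + ∫⁻ t, ENNReal.ofReal (theta (-t)) * f (-t) := by
    rw [← lintegral_add_left (by fun_prop)]
    apply lintegral_congr
    intro t
    have : f (-t) = f t := by simp [hf, SE_neg]
    rw [this, ← add_mul, ← ENNReal.ofReal_add (theta_nonneg _) (theta_nonneg _), theta_add]
    simp
  have h3 : ∫⁻ t, ENNReal.ofReal (theta (-t)) * f (-t) = ∫⁻ t, ENNReal.ofReal (theta t) * f t :=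
    lintegral_neg_eq_self (fun t => ENNReal.ofReal (theta t) * f t)
  rw [h2, h3]
  exact ENNReal.add_ne_top.2 ⟨h1, h1⟩

lemma energy (b c : ℝ) (hb : 0 ≤ b) (hc : 0 < c) (μ : Measure ℝ) [SFinite μ]
    (hfin : ∫⁻ t, ENNReal.ofReal (rexp (-|t|)) * SE μ t ≠ ⊤)
    (u : ℝ → ℝ) (hm : Measurable u) (hneg : ∀ x < 0, u x = 0) (h0 : ∀ x, 0 ≤ u x)
    (h1 : ∀ x, u x ≤ 1 / c)
    (heq : ∀ᵐ x : ℝ, ENNReal.ofReal c * ENNReal.ofReal (u x)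
      + ∫⁻ y, kE b μ (x - y) * ENNReal.ofReal (u y) = ENNReal.ofReal (theta x))
    (δ : ℝ) (hδ : 0 < δ) :
    Integrable (fun x => (u (x + δ) - u x) ^ 2) ∧
      ∫ x, (u (x + δ) - u x) ^ 2 ≤ δ / c ^ 2 := by
  have hS := SE_meas μ
  have hth := theta_meas
  have hth0 : ∀ x < 0, theta x = 0 := by
    intro x hx; simp [theta, hx.not_gt, hx.ne]
  have hth1 : ∀ x > 0, theta x = 1 := by
    intro x hx; simp [theta, hx]
  set k : ℝ → ℝ := fun t => theta t * (b + (SE μ t).toReal) with hk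
  have hkm : Measurable k := by fun_prop
  have hk0 : ∀ t, 0 ≤ k t := fun t => mul_nonneg (theta_nonneg t) (by positivity)
  have hkE : ∀ᵐ t, ENNReal.ofReal (k t) = kE b μ t := by
    have := ae_lt_top (by fun_prop) hfin
    filter_upwards [this] with t ht
    have : SE μ t ≠ ⊤ := by
      intro h
      rw [h, ENNReal.mul_top (by simp [exp_pos])] at ht
      exact lt_irrefl _ ht
    rw [hk, kE]
    simp only
    rw [ENNReal.ofReal_mul (theta_nonneg _), ENNReal.ofReal_add hb ENNReal.toReal_nonneg,
      ENNReal.ofReal_toReal this]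
  -- real form of the equation
  have hreal : ∀ᵐ x : ℝ, Integrable (fun y => k (x - y) * u y) ∧
      ∫ y, k (x - y) * u y = theta x - c * u x := by
    filter_upwards [heq] with x hx
    have hC : ∫⁻ y, ENNReal.ofReal (k (x - y) * u y)
        = ∫⁻ y, kE b μ (x - y) * ENNReal.ofReal (u y) := by
      apply lintegral_congr_ae
      have := (Measure.measurePreserving_sub_left (volume : Measure ℝ) x).quasiMeasurePreserving.ae hkE
      filter_upwards [this] with y hy
      rw [ENNReal.ofReal_mul (hk0 _), hy]
    rw [← hC] at hx
    have hne : ∫⁻ y, ENNReal.ofReal (k (x - y) * u y) ≠ ⊤ := by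
      intro h
      rw [h] at hx
      simp at hx
    have hnn : 0 ≤ᵐ[volume] fun y => k (x - y) * u y :=
      ae_of_all _ fun y => mul_nonneg (hk0 _) (h0 _)
    have hms : AEStronglyMeasurable (fun y => k (x - y) * u y) volume := by
      have : Measurable (fun y => k (x - y) * u y) := by fun_prop
      exact this.aestronglyMeasurable
    refine ⟨⟨hms, ?_⟩, ?_⟩
    · rw [hasFiniteIntegral_iff_ofReal hnn]; exact hne.lt_top
    · rw [integral_eq_lintegral_of_nonneg_ae hnn hms]
      have h2 := congrArg ENNReal.toReal hx
      rw [ENNReal.toReal_add (ENNReal.mul_ne_top ENNReal.ofReal_ne_top ENNReal.ofReal_ne_top) hne,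
        ENNReal.toReal_mul, ENNReal.toReal_ofReal hc.le, ENNReal.toReal_ofReal (h0 x),
        ENNReal.toReal_ofReal (theta_nonneg x)] at h2
      linarith
  have hreal2 := (measurePreserving_add_right (volume : Measure ℝ) δ).quasiMeasurePreserving.ae hreal
  set h : ℝ → ℝ := fun x => u (x + δ) - u x with hh
  have hhm : Measurable h := by fun_prop
  have hhb : ∀ x, |h x| ≤ 1 / c := by
    intro x
    rw [abs_le]
    have := h0 x; have := h1 x; have := h0 (x + δ); have := h1 (x + δ)
    constructor <;> simp only [hh] <;> linarith
  have hhneg : ∀ x < -δ, h x = 0 := by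
    intro x hx
    simp [hh, hneg x (by linarith), hneg (x + δ) (by linarith)]
  have hconv : ∀ᵐ x : ℝ, ∫ y, k (x - y) * h y = theta (x + δ) - theta x - c * h x := by
    filter_upwards [hreal, hreal2] with x ⟨i1, e1⟩ ⟨i2, e2⟩
    have i3 : Integrable (fun y => k (x - y) * u (y + δ)) := by
      have := i2.comp_add_right δ
      simpa only [add_sub_add_right_eq_sub] using this
    have e3 : ∫ y, k (x - y) * u (y + δ) = ∫ y, k (x + δ - y) * u y := by
      rw [← integral_add_right_eq_self (fun y => k (x + δ - y) * u y) δ]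
      simp only [add_sub_add_right_eq_sub]
    have : ∀ y, k (x - y) * h y = k (x - y) * u (y + δ) - k (x - y) * u y := by
      intro y; simp only [hh]; ring
    simp_rw [this]
    rw [integral_sub i3 i1, e3, e2, e1]
    simp only [hh]; ring
  have hN : ∀ N : ℕ, IntegrableOn (fun x => h x ^ 2) (Iic (N : ℝ)) ∧
      ∫ x in Iic (N : ℝ), h x ^ 2 ≤ δ / c ^ 2 := by
    intro N
    set g : ℝ → ℝ := (Iic (N : ℝ)).indicator h with hg
    have hgm : Measurable g := hhm.indicator measurableSet_Iic
    have hgb : ∀ x, |g x| ≤ 1 / c := by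
      intro x
      by_cases hx : x ∈ Iic (N : ℝ)
      · rw [hg, indicator_of_mem hx]; exact hhb x
      · rw [hg, indicator_of_notMem hx]; simp [hc.le]
    have hgR : ∀ x, max δ N < |x| → g x = 0 := by
      intro x hx
      by_cases hx' : x ∈ Iic (N : ℝ)
      · rw [hg, indicator_of_mem hx']
        apply hhneg
        rw [max_lt_iff] at hx
        have hx' : x ≤ N := hx'
        rcases abs_cases x with ⟨h, _⟩ | ⟨h, _⟩ <;> rw [h] at hx
        · linarith [hx.2]
        · linarith [hx.1]
      · rw [hg, indicator_of_notMem hx']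
    have hpd := pd b hb μ hfin g hgm (1 / c) (max δ N) hgb hgR
    have hcg : ∀ᵐ x : ℝ, g x * ∫ y, (theta (x - y) * (b + (SE μ (x - y)).toReal)) * g y
        = g x * (theta (x + δ) - theta x) - c * g x ^ 2 := by
      filter_upwards [hconv] with x hx
      by_cases hxN : x ∈ Iic (N : ℝ)
      · have : ∫ y, (theta (x - y) * (b + (SE μ (x - y)).toReal)) * g y = ∫ y, k (x - y) * h y := by
          congr 1; ext y
          by_cases hy : y ∈ Iic (N : ℝ)
          · rw [hg, indicator_of_mem hy]
          · have h1 : x ≤ N := hxN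
            have h2 : ¬ (y ≤ N) := hy
            have := hth0 (x - y) (by linarith)
            simp [hk, this]
        rw [this, hx, hg, indicator_of_mem hxN]
        ring
      · rw [hg, indicator_of_notMem hxN]; simp
    rw [integral_congr_ae hcg] at hpd
    have hsupp : ∀ f : ℝ → ℝ, Measurable f → (∃ M, ∀ x, |f x| ≤ M) →
        (∀ x, max δ N < |x| → f x = 0) → Integrable f := by
      rintro f hf ⟨M, hM⟩ hR
      have : f = (Icc (-(max δ N)) (max δ N)).indicator f := by
        ext x
        by_cases h : x ∈ Icc (-(max δ N)) (max δ N)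
        · simp only [h, indicator_of_mem]
        · rw [indicator_of_notMem h, hR]
          by_contra h'
          exact h (abs_le.1 (not_lt.1 h'))
      rw [this, integrable_indicator_iff measurableSet_Icc]
      exact Measure.integrableOn_of_bounded (M := M) (by simp) hf.aestronglyMeasurable
        (ae_of_all _ hM)
    have hi2 : Integrable (fun x => g x ^ 2) := by
      apply hsupp _ (by fun_prop)
      · refine ⟨(1 / c) ^ 2, fun x => ?_⟩
        rw [abs_pow]
        exact pow_le_pow_left₀ (abs_nonneg _) (hgb x) 2
      · intro x hx; simp [hgR x hx]
    have hthd : ∀ x, |theta (x + δ) - theta x| ≤ 1 := by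
      intro x
      rw [abs_le]
      have := theta_le x; have := theta_le (x + δ)
      have := theta_nonneg x; have := theta_nonneg (x + δ)
      constructor <;> linarith
    have hgd : ∀ x, |g x * (theta (x + δ) - theta x)| ≤ 1 / c := by
      intro x
      rw [abs_mul]
      calc _ ≤ (1 / c) * 1 := mul_le_mul (hgb x) (hthd x) (abs_nonneg _) (by positivity)
        _ = _ := mul_one _
    have hi1 : Integrable (fun x => g x * (theta (x + δ) - theta x)) := by
      apply hsupp _ (by fun_prop)
      · exact ⟨1 / c, hgd⟩
      · intro x hx; simp [hgR x hx]
    rw [integral_sub hi1 (hi2.const_mul c), integral_const_mul] at hpd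
    have hle : ∫ x, g x * (theta (x + δ) - theta x) ≤ δ / c := by
      calc _ ≤ ∫ x, (Icc (-δ) 0).indicator (fun _ => 1 / c) x := by
            apply integral_mono hi1
            · rw [integrable_indicator_iff measurableSet_Icc]
              exact integrableOn_const (by simp)
            · intro x
              by_cases hx : x ∈ Icc (-δ) 0
              · simp only [hx, indicator_of_mem]
                exact (le_abs_self _).trans (hgd x)
              · simp only [hx, not_false_eq_true, indicator_of_notMem]
                rw [mem_Icc, not_and_or] at hx
                rcases hx with hx | hx
                · have : h x = 0 := hhneg x (by linarith)
                  have : g x = 0 := by simp [hg, indicator, this]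
                  simp [this]
                · rw [hth1 x (by linarith), hth1 (x + δ) (by linarith)]; simp
        _ = _ := by
            rw [integral_indicator measurableSet_Icc, setIntegral_const]
            simp [hδ.le]
            rfl
    have hg2 : (fun x => g x ^ 2) = (Iic (N : ℝ)).indicator (fun x => h x ^ 2) := by
      ext x
      by_cases hx : x ∈ Iic (N : ℝ)
      · simp only [hg, hx, indicator_of_mem]
      · simp only [hg, hx, not_false_eq_true, indicator_of_notMem]; norm_num
    rw [hg2] at hi2 hpd
    rw [integral_indicator measurableSet_Iic] at hpd
    refine ⟨(integrable_indicator_iff measurableSet_Iic).1 hi2, ?_⟩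
    rw [le_div_iff₀ (by positivity)]
    have : c * ∫ x in Iic (N : ℝ), h x ^ 2 ≤ δ / c := by linarith
    rw [le_div_iff₀ hc] at this
    linarith
  have hcov : AECover (volume : Measure ℝ) atTop (fun N : ℕ => Iic (N : ℝ)) :=
    aecover_Iic tendsto_natCast_atTop_atTop
  have hint : Integrable (fun x => h x ^ 2) :=
    hcov.integrable_of_integral_bounded_of_nonneg_ae (δ / c ^ 2) (fun N => (hN N).1)
      (ae_of_all _ fun x => sq_nonneg _) (Eventually.of_forall fun N => (hN N).2)
  refine ⟨hint, ?_⟩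
  exact le_of_tendsto' (hcov.integral_tendsto_of_countably_generated hint) fun N => (hN N).2
/-- Lemma 2.2: L²-shift estimate for `e^{−λx} W′(x)`. -/
theorem stmt1
    (b c : ℝ) (hb : 0 ≤ b) (hc : 0 < c)
    (ν : Measure ℝ) (hν0 : ν (Set.Iic 0) = 0)
    (hνint : ∫⁻ y in Set.Ioi (0 : ℝ), ENNReal.ofReal (min y (y ^ 2)) ∂ν ≠ ⊤)
    (W W' : ℝ → ℝ)
    (hWneg : ∀ x : ℝ, x < 0 → W x = 0)
    (hWnonneg : ∀ x : ℝ, 0 ≤ W x)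
    (hWcont : ContinuousOn W (Set.Ici 0))
    (hWmono : StrictMonoOn W (Set.Ici 0))
    (hWlap : ∀ l : ℝ, 0 < l →
      (∫ x in Set.Ioi (0 : ℝ), Real.exp (-l * x) * W x) = 1 / phi b c ν l)
    (hW'neg : ∀ x : ℝ, x < 0 → W' x = 0)
    (hW'zero : W' 0 = 1 / c)
    (hW'deriv : ∀ x : ℝ, 0 < x → HasDerivAt W (W' x) x)
    (hW'cont : ContinuousOn W' (Set.Ici 0))
    :
    ∀ l : ℝ, 0 ≤ l → -b < l → ∃ C : ℝ, 0 < C ∧ ∀ δ : ℝ, 0 < δ →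
      (∫ x : ℝ, |Real.exp (-l * (x + δ)) * W' (x + δ) - Real.exp (-l * x) * W' x| ^ 2)
        ≤ C * δ := by
  intro l hl _
  have hsf := sfin ν hνint
  have hm : Measurable W' := by
    have : W' = (Ici (0:ℝ)).indicator W' := by
      ext x
      by_cases hx : x ∈ Ici (0:ℝ)
      · rw [indicator_of_mem hx]
      · rw [indicator_of_notMem hx]; exact hW'neg x (by simpa using hx)
    rw [this, ← piecewise_eq_indicator]
    exact ContinuousOn.measurable_piecewise hW'cont continuousOn_const measurableSet_Ici
  have hn : ∀ x, 0 ≤ W' x := by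
    intro x
    rcases lt_trichotomy x 0 with h | h | h
    · rw [hW'neg x h]
    · rw [h, hW'zero]; positivity
    · refine (hW'deriv x h).hasDerivWithinAt.nonneg_of_monotoneOn (s := Ici 0) ?_ hWmono.monotoneOn
      rw [accPt_principal_iff_nhdsWithin]
      have : Ioi x ⊆ Ici 0 \ {x} := fun y hy => by
        have hy : x < y := hy
        exact ⟨(h.trans hy).le, hy.ne'⟩
      exact NeBot.mono inferInstance (nhdsWithin_mono x this)
  have heq := main_eq b c hb hc ν hνint W' hm hW'neg
    (lap_u b c hb hc ν hνint W W' hWnonneg hWcont hWmono hWlap hW'neg hW'deriv hW'cont hm hn)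
  have hle : ∀ x, W' x ≤ 1 / c := by
    have hae : ∀ᵐ x : ℝ, W' x ≤ 1 / c := by
      filter_upwards [heq] with x hx
      have h1 : ENNReal.ofReal c * ENNReal.ofReal (W' x) ≤ ENNReal.ofReal (theta x) := by
        rw [← hx]; exact le_self_add
      rw [← ENNReal.ofReal_mul hc.le, ENNReal.ofReal_le_ofReal_iff (theta_nonneg x)] at h1
      rw [le_div_iff₀ hc]
      linarith [theta_le x]
    have hd := Measure.dense_of_ae hae
    intro x
    rcases lt_trichotomy x 0 with h | h | h
    · rw [hW'neg x h]; positivity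
    · rw [h, hW'zero]
    · by_contra hx
      push Not at hx
      have hca : ContinuousAt W' x := hW'cont.continuousAt (Ici_mem_nhds h)
      have hev : ∀ᶠ y in 𝓝 x, 1 / c < W' y := hca.eventually_const_lt hx
      have hfr : ∃ᶠ y in 𝓝 x, W' y ≤ 1 / c := mem_closure_iff_frequently.1 (hd x)
      obtain ⟨y, hy1, hy2⟩ := (hfr.and_eventually hev).exists
      linarith
  refine ⟨3 / c ^ 2, by positivity, fun δ hδ => ?_⟩
  obtain ⟨hi, hE⟩ := energy b c hb hc (ν.restrict (Ioi 0)) (hfin_lem ν hνint) W' hm hW'neg hn hle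
    heq δ hδ
  rcases hl.eq_or_lt with hl0 | hlpos
  · subst hl0
    simp only [neg_zero, zero_mul, Real.exp_zero, one_mul, sq_abs]
    refine hE.trans ?_
    rw [div_mul_eq_mul_div]
    gcongr
    linarith
  set q : ℝ := 1 - rexp (-l * δ) with hq
  have hq0 : 0 ≤ q := by
    have : rexp (-l * δ) ≤ 1 := Real.exp_le_one_iff.2 (by nlinarith)
    linarith
  have hq1 : q ≤ 1 := by have := exp_pos (-l * δ); linarith
  have hq2 : q ≤ l * δ := by have := Real.add_one_le_exp (-l * δ); linarith
  have hi2 : IntegrableOn (fun x => rexp (-(2 * l) * x)) (Ioi 0) :=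
    integrableOn_exp_mul_Ioi (by linarith) 0
  have hi2' := (integrable_indicator_iff measurableSet_Ioi).2 hi2
  have hI2 : ∫ x, (Ioi (0:ℝ)).indicator (fun x => rexp (-(2 * l) * x)) x = 1 / (2 * l) := by
    rw [integral_indicator measurableSet_Ioi, integral_exp_mul_Ioi (by linarith)]
    simp
  have hpt : ∀ᵐ x : ℝ, |Real.exp (-l * (x + δ)) * W' (x + δ) - Real.exp (-l * x) * W' x| ^ 2
      ≤ 2 * (W' (x + δ) - W' x) ^ 2
        + (2 * q * (1 / c) ^ 2) * (Ioi (0:ℝ)).indicator (fun x => rexp (-(2 * l) * x)) x := by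
    have h0 : ∀ᵐ y : ℝ, y ≠ 0 := by simp [ae_iff]
    filter_upwards [h0] with x hx0
    rw [sq_abs]
    have hid : Real.exp (-l * (x + δ)) * W' (x + δ) - Real.exp (-l * x) * W' x
        = rexp (-l * (x + δ)) * (W' (x + δ) - W' x) - q * (rexp (-l * x) * W' x) := by
      have : rexp (-l * (x + δ)) = rexp (-l * x) * rexp (-l * δ) := by
        rw [← Real.exp_add]; ring_nf
      rw [this, hq]; ring
    have hA : (rexp (-l * (x + δ)) * (W' (x + δ) - W' x)) ^ 2 ≤ (W' (x + δ) - W' x) ^ 2 := by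
      rcases lt_or_ge (x + δ) 0 with h | h
      · rw [hW'neg _ h, hW'neg x (by linarith)]; simp
      · have h1 : rexp (-l * (x + δ)) ≤ 1 := Real.exp_le_one_iff.2 (by nlinarith)
        rw [mul_pow]
        have h2 : rexp (-l * (x + δ)) ^ 2 ≤ 1 := pow_le_one₀ (exp_pos _).le h1
        exact mul_le_of_le_one_left (sq_nonneg _) h2
    have hB : (q * (rexp (-l * x) * W' x)) ^ 2
        ≤ q * (1 / c) ^ 2 * (Ioi (0:ℝ)).indicator (fun x => rexp (-(2 * l) * x)) x := by
      rcases lt_or_gt_of_ne hx0 with h | h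
      · rw [hW'neg x h]; simp [indicator, h.not_gt]
      · rw [indicator_of_mem (show x ∈ Ioi (0:ℝ) from h)]
        have he : rexp (-(2 * l) * x) = rexp (-l * x) ^ 2 := by
          rw [← Real.exp_nat_mul]; push_cast; ring_nf
        rw [he, mul_pow, mul_pow]
        have h1 : W' x ^ 2 ≤ (1 / c) ^ 2 := pow_le_pow_left₀ (hn x) (hle x) 2
        have h2 : q ^ 2 ≤ q := by nlinarith
        calc q ^ 2 * (rexp (-l * x) ^ 2 * W' x ^ 2) ≤ q * (rexp (-l * x) ^ 2 * (1 / c) ^ 2) := by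
              gcongr
          _ = _ := by ring
    rw [hid]
    nlinarith [sq_nonneg (rexp (-l * (x + δ)) * (W' (x + δ) - W' x) + q * (rexp (-l * x) * W' x))]
  have hfi := (hi.const_mul 2).add (hi2'.const_mul (2 * q * (1 / c) ^ 2))
  refine (integral_mono_of_nonneg (ae_of_all _ fun x => by positivity) hfi hpt).trans ?_
  simp only [Pi.add_apply]
  rw [integral_add (hi.const_mul 2) (hi2'.const_mul (2 * q * (1 / c) ^ 2)), integral_const_mul,
    integral_const_mul, hI2]
  have hlast : 2 * q * (1 / c) ^ 2 * (1 / (2 * l)) ≤ δ / c ^ 2 := by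
    have : 2 * q * (1 / c) ^ 2 * (1 / (2 * l)) = (q / l) / c ^ 2 := by field_simp
    rw [this]
    gcongr
    rw [div_le_iff₀ hlpos]; linarith
  have : 3 / c ^ 2 * δ = 2 * (δ / c ^ 2) + δ / c ^ 2 := by ring
  linarith
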